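/- Let Λ be a positive definite diagonal d×d real matrix, let g : ℝ^d → ℝ be convex, let F : ℝ^d → ℝ^d, let u_0 ∈ ℝ^d and a_0 > 0, and suppose u_1 minimizes v ↦ a_0⟨F(u_0), v⟩ + a_0 g(v) + (1/2)‖v − u_0‖_Λ² over ℝ^d. Suppose u* ∈ ℝ^d satisfies ⟨F(u_1), u_1 − u*⟩ + g(u_1) − g(u*) ≥ 0, and that a_0·‖F(u_0) − F(u_1)‖_{Λ⁻¹} ≤ (1/√2)·‖u_1 − u_0‖_Λ. Then ‖u_1 − u_0‖_Λ² ≤ 2·‖u* − u_0‖_Λ². -/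

import Mathlib

open Finset

/-- Squared Mahalanobis (semi)norm `‖x‖_Λ² = ∑ i, Λ i * (x i)²` for a diagonal
matrix with diagonal entries `Λ`. -/
noncomputable def mSq {d : ℕ} (Λ : Fin d → ℝ) (x : Fin d → ℝ) : ℝ :=
  ∑ i, Λ i * x i ^ 2

/-- Mahalanobis norm `‖x‖_Λ`. -/
noncomputable def mNorm {d : ℕ} (Λ : Fin d → ℝ) (x : Fin d → ℝ) : ℝ :=
  Real.sqrt (mSq Λ x)

/-- Mahalanobis norm `‖x‖_{Λ⁻¹}` with respect to the inverse diagonal matrix. -/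
noncomputable def mInvNorm {d : ℕ} (Λ : Fin d → ℝ) (x : Fin d → ℝ) : ℝ :=
  Real.sqrt (∑ i, (Λ i)⁻¹ * x i ^ 2)

/-- Standard inner product on `ℝ^d`. -/
noncomputable def dotR {d : ℕ} (x y : Fin d → ℝ) : ℝ := ∑ i, x i * y i

theorem mSq_nonneg {d : ℕ} {Λ : Fin d → ℝ} (hΛ : ∀ i, 0 < Λ i) (x : Fin d → ℝ) :
    0 ≤ mSq Λ x :=
  Finset.sum_nonneg fun i _ => mul_nonneg (hΛ i).le (sq_nonneg _)

theorem dotR_sub_left {d : ℕ} (x y z : Fin d → ℝ) :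
    dotR (x - y) z = dotR x z - dotR y z := by
  simp only [dotR, Pi.sub_apply, sub_mul, Finset.sum_sub_distrib]

theorem dotR_sub_right {d : ℕ} (x y z : Fin d → ℝ) :
    dotR x (y - z) = dotR x y - dotR x z := by
  simp only [dotR, Pi.sub_apply, mul_sub, Finset.sum_sub_distrib]

theorem dotR_convex_comb {d : ℕ} (x y z : Fin d → ℝ) (t : ℝ) :
    dotR x ((1 - t) • y + t • z) = (1 - t) * dotR x y + t * dotR x z := by
  simp only [dotR, Finset.mul_sum, ← Finset.sum_add_distrib, Pi.add_apply, Pi.smul_apply,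
    smul_eq_mul]
  exact Finset.sum_congr rfl fun i _ => by ring

theorem mSq_convex_comb_sub {d : ℕ} (Λ u y z : Fin d → ℝ) (t : ℝ) :
    mSq Λ ((1 - t) • y + t • z - u)
      = (1 - t) * mSq Λ (y - u) + t * mSq Λ (z - u) - t * (1 - t) * mSq Λ (z - y) := by
  simp only [mSq, Finset.mul_sum, ← Finset.sum_add_distrib, ← Finset.sum_sub_distrib,
    Pi.add_apply, Pi.sub_apply, Pi.smul_apply, smul_eq_mul]
  exact Finset.sum_congr rfl fun i _ => by ring

/-- Young's inequality for the dual pair of Mahalanobis norms. -/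
theorem neg_half_le_mul_dotR {d : ℕ} {Λ : Fin d → ℝ} (hΛ : ∀ i, 0 < Λ i) (a : ℝ)
    (x y : Fin d → ℝ) :
    -(1 / 2 * (a * mInvNorm Λ x) ^ 2 + 1 / 2 * mSq Λ y) ≤ a * dotR x y := by
  have hS : 0 ≤ ∑ i, (Λ i)⁻¹ * x i ^ 2 :=
    Finset.sum_nonneg fun i _ => mul_nonneg (inv_nonneg.2 (hΛ i).le) (sq_nonneg _)
  rw [mul_pow, mInvNorm, Real.sq_sqrt hS, mSq, dotR, neg_le_iff_add_nonneg]
  simp only [Finset.mul_sum, ← Finset.sum_add_distrib]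
  refine Finset.sum_nonneg fun i _ => ?_
  have hi := hΛ i
  have h : a * (x i * y i) + (1 / 2 * (a ^ 2 * ((Λ i)⁻¹ * x i ^ 2)) + 1 / 2 * (Λ i * y i ^ 2))
      = 1 / 2 * (Λ i)⁻¹ * (a * x i + Λ i * y i) ^ 2 := by
    field_simp
    ring
  rw [h]
  positivity

/-- The three-point inequality for a minimizer of a proximal objective. -/
theorem prox_three_point {d : ℕ} {Λ : Fin d → ℝ} (hΛ : ∀ i, 0 < Λ i)
    {g : (Fin d → ℝ) → ℝ} (hg : ConvexOn ℝ Set.univ g) {p u v : Fin d → ℝ} {a : ℝ}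
    (ha : 0 < a)
    (hmin : ∀ w : Fin d → ℝ,
      a * dotR p v + a * g v + 1 / 2 * mSq Λ (v - u)
        ≤ a * dotR p w + a * g w + 1 / 2 * mSq Λ (w - u)) (z : Fin d → ℝ) :
    a * dotR p v + a * g v + 1 / 2 * mSq Λ (v - u) + 1 / 2 * mSq Λ (z - v)
      ≤ a * dotR p z + a * g z + 1 / 2 * mSq Λ (z - u) := by
  have hB := mSq_nonneg hΛ (z - v)
  have key : ∀ t : ℝ, 0 < t → t ≤ 1 →
      a * dotR p v + a * g v + 1 / 2 * mSq Λ (v - u) + (1 - t) * (1 / 2 * mSq Λ (z - v))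
        ≤ a * dotR p z + a * g z + 1 / 2 * mSq Λ (z - u) := by
    intro t ht ht1
    have h := hmin ((1 - t) • v + t • z)
    have hc := mul_le_mul_of_nonneg_left
      (hg.2 (Set.mem_univ v) (Set.mem_univ z) (sub_nonneg.2 ht1) ht.le (by ring)) ha.le
    rw [dotR_convex_comb, mSq_convex_comb_sub] at h
    simp only [smul_eq_mul] at hc
    refine le_of_mul_le_mul_left ?_ ht
    linarith
  have hlim : Filter.Tendsto (fun t : ℝ => a * dotR p v + a * g v + 1 / 2 * mSq Λ (v - u)
      + (1 - t) * (1 / 2 * mSq Λ (z - v))) (nhdsWithin 0 (Set.Ioi 0))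
      (nhds (a * dotR p v + a * g v + 1 / 2 * mSq Λ (v - u)
        + (1 - 0) * (1 / 2 * mSq Λ (z - v)))) :=
    (Continuous.tendsto (by fun_prop) 0).mono_left nhdsWithin_le_nhds
  rw [sub_zero, one_mul] at hlim
  refine le_of_tendsto hlim ?_
  filter_upwards [Ioc_mem_nhdsGT (zero_lt_one' ℝ)] with t ht using key t ht.1 ht.2

theorem stmt8 {d : ℕ} (Λ : Fin d → ℝ) (hΛ : ∀ i, 0 < Λ i)
    (g : (Fin d → ℝ) → ℝ) (hg : ConvexOn ℝ Set.univ g)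
    (F : (Fin d → ℝ) → (Fin d → ℝ))
    (u0 u1 ustar : Fin d → ℝ) (a0 : ℝ) (ha0 : 0 < a0)
    (hmin : ∀ w : Fin d → ℝ,
      a0 * dotR (F u0) u1 + a0 * g u1 + 1 / 2 * mSq Λ (u1 - u0)
        ≤ a0 * dotR (F u0) w + a0 * g w + 1 / 2 * mSq Λ (w - u0))
    (hstar : 0 ≤ dotR (F u1) (u1 - ustar) + g u1 - g ustar)
    (hinit : a0 * mInvNorm Λ (F u0 - F u1) ≤ 1 / Real.sqrt 2 * mNorm Λ (u1 - u0)) :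
    mSq Λ (u1 - u0) ≤ 2 * mSq Λ (ustar - u0) := by
  have h3 := prox_three_point hΛ hg ha0 hmin ustar
  have hy := neg_half_le_mul_dotR hΛ a0 (F u0 - F u1) (u1 - ustar)
  have hsq : (a0 * mInvNorm Λ (F u0 - F u1)) ^ 2 ≤ 1 / 2 * mSq Λ (u1 - u0) := by
    refine (pow_le_pow_left₀ (mul_nonneg ha0.le (Real.sqrt_nonneg _)) hinit 2).trans_eq ?_
    rw [mul_pow, mNorm, Real.sq_sqrt (mSq_nonneg hΛ _), div_pow, Real.sq_sqrt zero_le_two,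
      one_pow]
  have hsymm : mSq Λ (u1 - ustar) = mSq Λ (ustar - u1) := by
    simp only [mSq, Pi.sub_apply, sub_sq_comm]
  have hs := mul_nonneg ha0.le hstar
  rw [dotR_sub_left, dotR_sub_right, dotR_sub_right, hsymm] at hy
  rw [dotR_sub_right] at hs
  linarith
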